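/- arXiv:2403.02252 — 2 statements merged into one kernel-verified Lean document; each statement's English description precedes it below -/
import Mathlib

section
/- Let q(z) = Σ_{j=1}^∞ q_j z^j be a power series with q_j ≥ 0 for all j, no constant term, and 0 < q(1) := Σ_{j=1}^∞ q_j < ∞. Suppose Φ is analytic on the open unit disc with Φ(0) = 0 and Φ'(0) = 1 and satisfies, for all |z| < 1, the integrated equation ∫_{[0,z]} (Φ(w)/w) dw = (q(1) − q(z))·Φ(z)/q(1) (segment integral, integrand extended by Φ'(0) at 0). Then Φ(z) = z·exp(∫_{[0,z]} (q'(ζ)ζ + q(ζ)) / ((q(1) − q(ζ))ζ) dζ) for all |z| < 1; i.e. this equation has a unique analytic solution with these initial conditions. -/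
open MeasureTheory

/-- The power series `q(z) = Σ_{j≥1} q_j z^j` as a function on `ℂ`. -/
noncomputable def qFun (q : ℕ → ℝ) : ℂ → ℂ := fun z => ∑' j, (q j : ℂ) * z ^ j

/-- An analytic function `f` on the unit disc vanishing at `0` has a primitive of `f(w)/w`, and it is
computed by integrating along radii. -/
theorem exists_primitive_dslope_zero {f : ℂ → ℂ} (hf : DifferentiableOn ℂ f (Metric.ball 0 1))
    (hf0 : f 0 = 0) :
    ∃ F : ℂ → ℂ, F 0 = 0 ∧ (∀ z ∈ Metric.ball (0 : ℂ) 1, HasDerivAt F (dslope f 0 z) z) ∧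
      ∀ z ∈ Metric.ball (0 : ℂ) 1, (∫ t in (0 : ℝ)..1, f ((t : ℂ) * z) / (t : ℂ)) = F z := by
  have hd : DifferentiableOn ℂ (dslope f 0) (Metric.ball 0 1) :=
    (Complex.differentiableOn_dslope (Metric.ball_mem_nhds 0 one_pos)).2 hf
  obtain ⟨F, hF0, hF⟩ := hd.isExactOn_ball.with_val_at 0 0
  refine ⟨F, hF0, hF, fun z hz => ?_⟩
  have hmem : ∀ t ∈ Set.uIcc (0 : ℝ) 1, (t : ℂ) * z ∈ Metric.ball (0 : ℂ) 1 := by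
    intro t ht
    rw [Set.uIcc_of_le zero_le_one] at ht
    rw [mem_ball_zero_iff] at hz ⊢
    rw [norm_mul, Complex.norm_real, Real.norm_of_nonneg ht.1]
    exact (mul_le_of_le_one_left (norm_nonneg z) ht.2).trans_lt hz
  have hmap : ContinuousOn (fun t : ℝ => (t : ℂ) * z) (Set.uIcc 0 1) := by fun_prop
  have hint := intervalIntegral.integral_eq_sub_of_hasDerivAt (a := (0 : ℝ)) (b := 1)
    (f := fun t : ℝ => F ((t : ℂ) * z)) (f' := fun t : ℝ => dslope f 0 ((t : ℂ) * z) * z)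
    (fun t ht => by
      have h1 : HasDerivAt (fun s : ℝ => (s : ℂ) * z) z t := by
        simpa using (Complex.ofRealCLM.hasDerivAt (x := t)).mul_const z
      exact (hF _ (hmem t ht)).comp t h1)
    (((hd.continuousOn.comp hmap hmem).mul continuousOn_const).intervalIntegrable)
  simp only [Complex.ofReal_one, one_mul, Complex.ofReal_zero, zero_mul, hF0, sub_zero] at hint
  rw [← hint]
  refine intervalIntegral.integral_congr_ae (Filter.Eventually.of_forall fun t ht => ?_)
  rw [Set.uIoc_of_le zero_le_one] at ht
  have ht0 : (t : ℂ) ≠ 0 := Complex.ofReal_ne_zero.2 ht.1.ne'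
  have h := sub_smul_dslope_of_zero hf0 ((t : ℂ) * z)
  rw [sub_zero, smul_eq_mul] at h
  rw [← h]
  field_simp

theorem differentiableOn_qFun {q : ℕ → ℝ} (hqnn : ∀ j, 0 ≤ q j) (hsum : Summable q) :
    DifferentiableOn ℂ (qFun q) (Metric.ball 0 1) := by
  refine Complex.differentiableOn_tsum_of_summable_norm hsum (fun j => by fun_prop)
    Metric.isOpen_ball fun j w hw => ?_
  rw [norm_mul, norm_pow, Complex.norm_real, Real.norm_of_nonneg (hqnn j)]
  exact mul_le_of_le_one_right (hqnn j)
    (pow_le_one₀ (norm_nonneg w) (mem_ball_zero_iff.1 hw).le)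

theorem norm_qFun_le {q : ℕ → ℝ} (hq0 : q 0 = 0) (hqnn : ∀ j, 0 ≤ q j) (hsum : Summable q)
    {z : ℂ} (hz : ‖z‖ ≤ 1) : ‖qFun q z‖ ≤ (∑' j, q j) * ‖z‖ := by
  refine tsum_of_norm_bounded (hsum.hasSum.mul_right ‖z‖) fun j => ?_
  rw [norm_mul, norm_pow, Complex.norm_real, Real.norm_of_nonneg (hqnn j)]
  rcases eq_or_ne j 0 with rfl | hj
  · simp [hq0]
  · exact mul_le_mul_of_nonneg_left (pow_le_of_le_one (norm_nonneg z) hz hj) (hqnn j)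

theorem qFun_zero {q : ℕ → ℝ} (hq0 : q 0 = 0) : qFun q 0 = 0 := by
  rw [qFun, tsum_eq_single 0 fun j hj => by simp [hj]]
  simp [hq0]

/-- A solution of `H' = G H` on a disc, with the equation known off the centre, is determined by
a primitive `A` of `G`. -/
theorem eq_mul_exp_of_deriv_eq_mul {H G A : ℂ → ℂ}
    (hH : DifferentiableOn ℂ H (Metric.ball 0 1)) (hG : DifferentiableOn ℂ G (Metric.ball 0 1))
    (hA : ∀ z ∈ Metric.ball (0 : ℂ) 1, HasDerivAt A (G z) z) (hA0 : A 0 = 0)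
    (hode : ∀ z ∈ Metric.ball (0 : ℂ) 1, z ≠ 0 → deriv H z = G z * H z) :
    ∀ z ∈ Metric.ball (0 : ℂ) 1, H z = H 0 * Complex.exp (A z) := by
  have hnhds : ∀ z ∈ Metric.ball (0 : ℂ) 1, Metric.ball (0 : ℂ) 1 ∈ nhds z :=
    fun z hz => Metric.isOpen_ball.mem_nhds hz
  have hb0 := hnhds 0 (Metric.mem_ball_self one_pos)
  have hode0 : deriv H 0 = G 0 * H 0 := by
    have hc1 : ContinuousAt (deriv H) 0 :=
      ((hH.deriv Metric.isOpen_ball).differentiableAt hb0).continuousAt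
    have hc2 : ContinuousAt (fun z => G z * H z) 0 :=
      (hG.continuousOn.continuousAt hb0).mul (hH.continuousOn.continuousAt hb0)
    refine ((hc1.eventuallyEq_nhds_iff_eventuallyEq_nhdsNE hc2).1 ?_).eq_of_nhds
    filter_upwards [self_mem_nhdsWithin, mem_nhdsWithin_of_mem_nhds hb0] with z hz0 hz
    exact hode z hz hz0
  have hM : ∀ z ∈ Metric.ball (0 : ℂ) 1,
      HasDerivAt (fun w => H w * Complex.exp (-A w)) 0 z := by
    intro z hz
    have hHz := (hH.differentiableAt (hnhds z hz)).hasDerivAt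
    have hode' : deriv H z = G z * H z := by
      rcases eq_or_ne z 0 with rfl | h
      exacts [hode0, hode z hz h]
    rw [hode'] at hHz
    exact (hHz.mul (hA z hz).neg.cexp).congr_deriv (by ring)
  intro z hz
  have hconst : H z * Complex.exp (-A z) = H 0 * Complex.exp (-A 0) :=
    Metric.isOpen_ball.is_const_of_deriv_eq_zero (convex_ball 0 1).isPreconnected
      (fun w hw => (hM w hw).differentiableAt.differentiableWithinAt)
      (fun w hw => (hM w hw).deriv) hz (Metric.mem_ball_self one_pos)
  rw [hA0, neg_zero, Complex.exp_zero, mul_one] at hconst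
  rw [← hconst, mul_assoc, ← Complex.exp_add, neg_add_cancel, Complex.exp_zero, mul_one]

/-- uniqueness: if `Φ` is analytic on the open unit disc with `Φ(0) = 0`,
`Φ'(0) = 1`, and satisfies the integrated equation
`∫_{[0,z]} Φ(w)/w dw = (q(1) − q(z))·Φ(z)/q(1)` for all `|z| < 1` (segment integrals
written via the parametrization `w = t·z`, resp. `ζ = t·z`, `t ∈ [0,1]`), then
`Φ(z) = z·exp(∫_{[0,z]} (q'(ζ)ζ + q(ζ))/((q(1) − q(ζ))ζ) dζ)` for all `|z| < 1`. -/
theorem schroder_solution_unique (q : ℕ → ℝ) (hq0 : q 0 = 0) (hqnn : ∀ j, 0 ≤ q j)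
    (hsum : Summable q) (hQ1 : 0 < ∑' j, q j)
    (Φ : ℂ → ℂ) (hΦ : AnalyticOnNhd ℂ Φ (Metric.ball 0 1)) (hΦ0 : Φ 0 = 0)
    (hΦ'0 : deriv Φ 0 = 1)
    (heq : ∀ z : ℂ, ‖z‖ < 1 →
      (∫ t in (0 : ℝ)..1, Φ ((t : ℂ) * z) / (t : ℂ)) =
        (((∑' j, q j : ℝ) : ℂ) - qFun q z) * Φ z / ((∑' j, q j : ℝ) : ℂ)) :
    ∀ z : ℂ, ‖z‖ < 1 →
      Φ z = z * Complex.exp (∫ t in (0 : ℝ)..1,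
        (deriv (qFun q) ((t : ℂ) * z) * ((t : ℂ) * z) + qFun q ((t : ℂ) * z)) /
          (((∑' j, q j : ℝ) : ℂ) - qFun q ((t : ℂ) * z)) / (t : ℂ)) := by
  set Q : ℝ := ∑' j, q j
  have hq := differentiableOn_qFun hqnn hsum
  have hQne : (Q : ℂ) ≠ 0 := Complex.ofReal_ne_zero.2 hQ1.ne'
  have hne : ∀ z ∈ Metric.ball (0 : ℂ) 1, (Q : ℂ) - qFun q z ≠ 0 := by
    intro z hz h
    rw [mem_ball_zero_iff] at hz
    have hle := norm_qFun_le hq0 hqnn hsum hz.le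
    rw [← sub_eq_zero.1 h, Complex.norm_real, Real.norm_of_nonneg hQ1.le] at hle
    nlinarith
  set g : ℂ → ℂ := fun w => (deriv (qFun q) w * w + qFun q w) / ((Q : ℂ) - qFun q w) with hg
  have hgd : DifferentiableOn ℂ g (Metric.ball 0 1) :=
    (((hq.deriv Metric.isOpen_ball).mul differentiableOn_id).add hq).div (hq.const_sub _) hne
  have hg0 : g 0 = 0 := by simp [hg, qFun_zero hq0]
  obtain ⟨A, hA0, hA, hAint⟩ := exists_primitive_dslope_zero hgd hg0
  obtain ⟨K, -, hK, hKint⟩ := exists_primitive_dslope_zero hΦ.differentiableOn hΦ0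
  have hnhds : Metric.ball (0 : ℂ) 1 ∈ nhds 0 := Metric.ball_mem_nhds 0 one_pos
  have hHd := (Complex.differentiableOn_dslope hnhds).2 hΦ.differentiableOn
  have hGd := (Complex.differentiableOn_dslope hnhds).2 hgd
  have hmul : ∀ {f : ℂ → ℂ}, f 0 = 0 → ∀ z, z * dslope f 0 z = f z := fun hf z => by
    simpa using sub_smul_dslope_of_zero hf z
  have hode : ∀ z ∈ Metric.ball (0 : ℂ) 1, z ≠ 0 →
      deriv (dslope Φ 0) z = dslope g 0 z * dslope Φ 0 z := by
    intro z hz hz0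
    have hzn := Metric.isOpen_ball.mem_nhds hz
    have hH := (hHd.differentiableAt hzn).hasDerivAt
    have hqz := (hq.differentiableAt hzn).hasDerivAt
    have hR : HasDerivAt K _ z :=
      (((hqz.const_sub (Q : ℂ)).mul ((hasDerivAt_id z).mul hH)).div_const
        (Q : ℂ)).congr_of_eventuallyEq (by
          filter_upwards [hzn] with w hw
          rw [← hKint w hw, heq w (mem_ball_zero_iff.1 hw), ← hmul hΦ0 w]
          rfl)
    have hkey := (hK z hz).unique hR
    have hgz := hmul hg0 z
    have hnez := hne z hz
    simp only [hg] at hgz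
    rw [eq_div_iff hnez] at hgz
    simp only [id, one_mul, Pi.mul_apply] at hkey
    rw [eq_div_iff hQne] at hkey
    refine mul_left_cancel₀ (mul_ne_zero hnez hz0) ?_
    linear_combination (-1 : ℂ) * hkey - dslope Φ 0 z * hgz
  intro z hz
  have hzb : z ∈ Metric.ball (0 : ℂ) 1 := mem_ball_zero_iff.2 hz
  rw [← hmul hΦ0 z, eq_mul_exp_of_deriv_eq_mul hHd hGd hA hA0 hode z hzb, dslope_same, hΦ'0,
    one_mul, ← hAint z hzb]
end

section
/- Let q be a polynomial of degree N ≥ 1 with nonnegative coefficients and q(0) = 0, and suppose the equation q(z) = q(1) has N distinct complex roots b_1, …, b_N. Then the function Φ(z) := z·∏_{j=1}^N (1 − z/b_j)^{−1 − q(1)/(q'(b_j) b_j)} (principal-branch complex powers; note Re(1 − z/b_j) > 0 for |z| < 1 since |b_j| ≥ 1) is analytic on the open unit disc, satisfies Φ(0) = 0, Φ'(0) = 1, and for every z with 0 < |z| < 1 satisfies ∫_0^∞ Φ(z·exp(r(q(z) − q(1)))) dr = Φ(z)/q(1). -/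
open MeasureTheory Polynomial

/-- The closed-form solution `Φ(z) = z·∏_j (1 − z/b_j)^(−1 − q(1)/(q'(b_j)b_j))`
(principal-branch complex powers) of Corollary 1. -/
noncomputable def PhiProd (N : ℕ) (q : Polynomial ℝ) (b : Fin N → ℂ) : ℂ → ℂ :=
  fun z => z * ∏ j, (1 - z / b j) ^
    (-1 - ((q.eval 1 : ℝ) : ℂ) / (Polynomial.aeval (b j) q.derivative * b j))

section PartialFractions

variable {N : ℕ} {p : ℂ[X]} {b : Fin N → ℂ}

theorem eq_zero_of_natDegree_lt_of_eval_injective (hb : Function.Injective b)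
    (hp : p.natDegree < N) (hroot : ∀ j, p.eval (b j) = 0) : p = 0 :=
  eq_zero_of_natDegree_lt_card_of_eval_eq_zero p hb hroot (by simpa using hp)

theorem eval_divByMonic_self (j : Fin N) (hj : p.eval (b j) = 0) :
    (p /ₘ (X - C (b j))).eval (b j) = p.derivative.eval (b j) := by
  have h := mul_divByMonic_eq_iff_isRoot.2 (show p.IsRoot (b j) from hj)
  conv_rhs => rw [← h]
  simp

theorem sub_mul_eval_divByMonic (j : Fin N) (hj : p.eval (b j) = 0) (z : ℂ) :
    (z - b j) * (p /ₘ (X - C (b j))).eval z = p.eval z := by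
  have h := congrArg (eval z) (mul_divByMonic_eq_iff_isRoot.2 (show p.IsRoot (b j) from hj))
  simpa using h

theorem eval_divByMonic_of_ne (hb : Function.Injective b) (hroot : ∀ j, p.eval (b j) = 0)
    {i j : Fin N} (hij : i ≠ j) : (p /ₘ (X - C (b j))).eval (b i) = 0 := by
  have h := sub_mul_eval_divByMonic j (hroot j) (b i)
  rw [hroot i] at h
  exact (mul_eq_zero.1 h).resolve_left (sub_ne_zero.2 (hb.ne hij))

theorem derivative_eval_ne_zero_of_injective (hN : 1 ≤ N) (hdeg : p.natDegree = N)
    (hb : Function.Injective b) (hroot : ∀ j, p.eval (b j) = 0) (j : Fin N) :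
    p.derivative.eval (b j) ≠ 0 := by
  intro h0
  have hR : p /ₘ (X - C (b j)) = 0 := by
    refine eq_zero_of_natDegree_lt_of_eval_injective hb ?_ fun i => ?_
    · rw [natDegree_divByMonic _ (monic_X_sub_C _), natDegree_X_sub_C]
      omega
    · rcases eq_or_ne i j with rfl | hij
      · rw [eval_divByMonic_self i (hroot i), h0]
      · exact eval_divByMonic_of_ne hb hroot hij
  have h := mul_divByMonic_eq_iff_isRoot.2 (show p.IsRoot (b j) from hroot j)
  rw [hR, mul_zero] at h
  rw [← h, natDegree_zero] at hdeg
  omega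

/-- Lagrange interpolation at `0` and at the simple roots of `p`. -/
theorem mul_sum_divByMonic_eq (hN : 1 ≤ N) (hdeg : p.natDegree = N)
    (hb : Function.Injective b) (hroot : ∀ j, p.eval (b j) = 0) (h0 : ∀ j, b j ≠ 0) (z : ℂ) :
    z * ∑ j, (1 - p.eval 0 / (p.derivative.eval (b j) * b j)) * (p /ₘ (X - C (b j))).eval z =
      z * p.derivative.eval z + p.eval z - p.eval 0 := by
  let D : ℂ[X] := X * ∑ j, C (1 - p.eval 0 / (p.derivative.eval (b j) * b j)) *
    (p /ₘ (X - C (b j))) - (X * derivative p + p - C (p.eval 0))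
  have hD : D = 0 := by
    have hinj : Function.Injective (Fin.cons 0 b : Fin (N + 1) → ℂ) :=
      Fin.cons_injective_iff.2 ⟨by rintro ⟨j, hj⟩; exact h0 j hj, hb⟩
    refine eq_zero_of_natDegree_lt_of_eval_injective hinj ?_ fun i => ?_
    · have h1 : (∑ j, C (1 - p.eval 0 / (p.derivative.eval (b j) * b j)) *
          (p /ₘ (X - C (b j)))).natDegree ≤ N - 1 := by
        refine natDegree_sum_le_of_forall_le _ _ fun j _ => ?_
        refine (natDegree_C_mul_le _ _).trans ?_
        rw [natDegree_divByMonic _ (monic_X_sub_C _), natDegree_X_sub_C, hdeg]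
      have h2 : (derivative p).natDegree ≤ N - 1 := hdeg ▸ natDegree_derivative_le p
      have hX {r : ℂ[X]} (hr : r.natDegree ≤ N - 1) : (X * r).natDegree ≤ N := by
        refine natDegree_mul_le.trans ?_
        rw [natDegree_X]
        omega
      refine Nat.lt_succ_of_le (natDegree_sub_le_of_le (hX h1) ?_ |>.trans (max_self N).le)
      refine (natDegree_sub_le_of_le (natDegree_add_le_of_degree_le (hX h2) hdeg.le)
        (natDegree_C _).le).trans (by simp)
    · refine Fin.cases ?_ (fun i => ?_) i
      · simp [D]
      · have hd := derivative_eval_ne_zero_of_injective hN hdeg hb hroot i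
        have hs : ∑ j, (1 - p.eval 0 / (p.derivative.eval (b j) * b j)) *
            (p /ₘ (X - C (b j))).eval (b i) =
            (1 - p.eval 0 / (p.derivative.eval (b i) * b i)) * p.derivative.eval (b i) := by
          rw [Finset.sum_eq_single i, eval_divByMonic_self i (hroot i)]
          · intro j _ hj
            rw [eval_divByMonic_of_ne hb hroot hj.symm, mul_zero]
          · simp
        simp only [D, Fin.cons_succ, eval_sub, eval_mul, eval_X, eval_finsetSum, eval_C,
          eval_add, hroot i, hs]
        field_simp [h0 i]
        ring
  have h := congrArg (eval z) hD
  simp only [D, eval_sub, eval_mul, eval_X, eval_finsetSum, eval_C, eval_add, eval_zero] at h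
  exact sub_eq_zero.1 h

end PartialFractions

section NonnegCoefficients

variable {q : ℝ[X]}

theorem eval_one_pos_of_coeff_nonneg (hq : q ≠ 0) (hcoeff : ∀ i, 0 ≤ q.coeff i) :
    0 < q.eval 1 := by
  rw [eval_eq_sum_range]
  refine Finset.sum_pos' (fun i _ => by simpa using hcoeff i)
    ⟨q.natDegree, by simp, ?_⟩
  simpa using lt_of_le_of_ne (hcoeff _) (leadingCoeff_ne_zero.2 hq).symm

theorem norm_aeval_le_norm_mul_eval_one (hcoeff : ∀ i, 0 ≤ q.coeff i) (hq0 : q.coeff 0 = 0)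
    {z : ℂ} (hz : ‖z‖ ≤ 1) : ‖aeval z q‖ ≤ ‖z‖ * q.eval 1 := by
  rw [aeval_eq_sum_range, eval_eq_sum_range, Finset.mul_sum]
  refine (norm_sum_le _ _).trans (Finset.sum_le_sum fun i _ => ?_)
  rw [norm_smul, norm_pow, Real.norm_of_nonneg (hcoeff i), one_pow, mul_one, mul_comm]
  rcases Nat.eq_zero_or_pos i with rfl | hi
  · simp [hq0]
  · exact mul_le_mul_of_nonneg_right (pow_le_of_le_one (norm_nonneg z) hz hi.ne') (hcoeff i)

theorem one_le_norm_of_aeval_eq_eval_one (hq : q ≠ 0) (hcoeff : ∀ i, 0 ≤ q.coeff i)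
    (hq0 : q.coeff 0 = 0) {z : ℂ} (hz : aeval z q = ((q.eval 1 : ℝ) : ℂ)) : 1 ≤ ‖z‖ := by
  by_contra! h
  have hA := eval_one_pos_of_coeff_nonneg hq hcoeff
  have h1 := norm_aeval_le_norm_mul_eval_one hcoeff hq0 h.le
  rw [hz, Complex.norm_real, Real.norm_of_nonneg hA.le] at h1
  nlinarith

theorem re_aeval_sub_eval_one_neg (hq : q ≠ 0) (hcoeff : ∀ i, 0 ≤ q.coeff i)
    (hq0 : q.coeff 0 = 0) {z : ℂ} (hz : ‖z‖ < 1) :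
    (aeval z q - ((q.eval 1 : ℝ) : ℂ)).re < 0 := by
  have hA := eval_one_pos_of_coeff_nonneg hq hcoeff
  have h1 := (Complex.re_le_norm _).trans (norm_aeval_le_norm_mul_eval_one hcoeff hq0 hz.le)
  rw [Complex.sub_re, Complex.ofReal_re]
  nlinarith

end NonnegCoefficients

theorem one_sub_div_mem_slitPlane {z w : ℂ} (hz : ‖z‖ < 1) (hw : 1 ≤ ‖w‖) :
    1 - z / w ∈ Complex.slitPlane := by
  left
  have h : ‖z / w‖ < 1 := by
    rw [norm_div, div_lt_one (by linarith)]
    linarith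
  have := Complex.re_le_norm (z / w)
  rw [Complex.sub_re, Complex.one_re]
  linarith

theorem hasDerivAt_one_sub_div_cpow {z w : ℂ} (c : ℂ) (hz : ‖z‖ < 1) (hw : 1 ≤ ‖w‖) :
    HasDerivAt (fun z => (1 - z / w) ^ c) ((1 - z / w) ^ c * (c / (z - w))) z := by
  have hs := one_sub_div_mem_slitPlane hz hw
  have hne := Complex.slitPlane_ne_zero hs
  have hw0 : w ≠ 0 := by
    rintro rfl
    norm_num at hw
  have hd : HasDerivAt (fun z : ℂ => 1 - z / w) (-(1 / w)) z :=
    ((hasDerivAt_id z).div_const w).const_sub 1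
  have hzw : z - w ≠ 0 := by
    rw [sub_ne_zero]
    rintro rfl
    linarith
  convert hd.cpow_const (c := c) hs using 1
  rw [Complex.cpow_sub _ _ hne, Complex.cpow_one]
  generalize (1 - z / w) ^ c = t
  rw [show 1 - z / w = -((z - w) / w) by field_simp; ring]
  field_simp

theorem hasDerivAt_prod_of_eq_mul {ι : Type*} [Fintype ι] {f : ι → ℂ → ℂ} {g : ι → ℂ} {z : ℂ}
    (hf : ∀ j, HasDerivAt (f j) (f j z * g j) z) :
    HasDerivAt (fun z => ∏ j, f j z) ((∏ j, f j z) * ∑ j, g j) z := by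
  classical
  refine (HasDerivAt.fun_finsetProd (u := Finset.univ) fun j _ => hf j).congr_deriv ?_
  rw [Finset.mul_sum]
  refine Finset.sum_congr rfl fun j hj => ?_
  rw [smul_eq_mul, ← mul_assoc, Finset.prod_erase_mul _ _ hj]

/-- The factor `Φ(z) / z` of `PhiProd`. -/
noncomputable def phiFactor (N : ℕ) (q : ℝ[X]) (b : Fin N → ℂ) (z : ℂ) : ℂ :=
  ∏ j, (1 - z / b j) ^ (-1 - ((q.eval 1 : ℝ) : ℂ) / (aeval (b j) q.derivative * b j))

section PhiProd

variable {N : ℕ} {q : ℝ[X]} {b : Fin N → ℂ}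

theorem phiProd_eq_mul (z : ℂ) : PhiProd N q b z = z * phiFactor N q b z := rfl

theorem phiFactor_zero : phiFactor N q b 0 = 1 := by simp [phiFactor]

theorem hasDerivAt_phiFactor (hb1 : ∀ j, 1 ≤ ‖b j‖) {z : ℂ} (hz : ‖z‖ < 1) :
    HasDerivAt (phiFactor N q b) (phiFactor N q b z * ∑ j,
      (-1 - ((q.eval 1 : ℝ) : ℂ) / (aeval (b j) q.derivative * b j)) / (z - b j)) z :=
  hasDerivAt_prod_of_eq_mul fun j => hasDerivAt_one_sub_div_cpow _ hz (hb1 j)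

theorem hasDerivAt_aeval_sub_mul_phiProd (hN : 1 ≤ N) (hdeg : q.natDegree = N)
    (hq0 : q.coeff 0 = 0) (hb : Function.Injective b)
    (hroot : ∀ j, aeval (b j) q = ((q.eval 1 : ℝ) : ℂ)) (hb1 : ∀ j, 1 ≤ ‖b j‖)
    {z : ℂ} (hz : ‖z‖ < 1) :
    HasDerivAt (fun z => (aeval z q - ((q.eval 1 : ℝ) : ℂ)) * PhiProd N q b z)
      (-((q.eval 1 : ℝ) : ℂ) * phiFactor N q b z) z := by
  set A : ℂ := ((q.eval 1 : ℝ) : ℂ) with hA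
  set p : ℂ[X] := q.map (algebraMap ℝ ℂ) - C A with hp
  have hpe (w : ℂ) : p.eval w = aeval w q - A := by simp [hp, aeval_def, eval_map]
  have hpd (w : ℂ) : p.derivative.eval w = aeval w q.derivative := by
    simp [hp, aeval_def, eval_map, derivative_map]
  have hp0 : p.eval 0 = -A := by
    rw [hpe, aeval_def, eval₂_at_zero, hq0]
    simp
  have hpdeg : p.natDegree = N := by
    rw [hp, natDegree_sub_C, natDegree_map, hdeg]
  have hproot (j : Fin N) : p.eval (b j) = 0 := by rw [hpe, hroot, sub_self]
  have hb0 (j : Fin N) : b j ≠ 0 := norm_pos_iff.1 (zero_lt_one.trans_le (hb1 j))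
  have hsum := mul_sum_divByMonic_eq hN hpdeg hb hproot hb0 z
  have hP : HasDerivAt (fun w => aeval w q - A) (p.derivative.eval z) z :=
    (p.hasDerivAt z).congr_of_eventuallyEq (.of_forall fun w => (hpe w).symm)
  have hΦ : HasDerivAt (PhiProd N q b) (1 * phiFactor N q b z + z * (phiFactor N q b z *
      ∑ j, (-1 - A / (aeval (b j) q.derivative * b j)) / (z - b j))) z :=
    (hasDerivAt_id z).mul (hasDerivAt_phiFactor (q := q) hb1 hz)
  refine (hP.mul hΦ).congr_deriv ?_
  have hS : p.eval z * ∑ j, (-1 - A / (aeval (b j) q.derivative * b j)) / (z - b j) =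
      -∑ j, (1 - p.eval 0 / (p.derivative.eval (b j) * b j)) *
        (p /ₘ (X - C (b j))).eval z := by
    rw [Finset.mul_sum, ← Finset.sum_neg_distrib]
    refine Finset.sum_congr rfl fun j _ => ?_
    have hzb : z - b j ≠ 0 := by
      rw [sub_ne_zero]
      rintro rfl
      exact (hb1 j).not_gt hz
    rw [← sub_mul_eval_divByMonic j (hproot j) z, hp0, hpd, mul_div_assoc', div_eq_iff hzb]
    ring
  rw [phiProd_eq_mul, ← hpe]
  rw [hp0] at hsum hS
  linear_combination z * phiFactor N q b z * hS - phiFactor N q b z * hsum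

theorem differentiableOn_phiProd (hb1 : ∀ j, 1 ≤ ‖b j‖) :
    DifferentiableOn ℂ (PhiProd N q b) (Metric.ball 0 1) := fun _ hz =>
  (differentiableAt_id.mul (hasDerivAt_phiFactor (q := q) hb1
    (mem_ball_zero_iff.1 hz)).differentiableAt).differentiableWithinAt

theorem deriv_phiProd_zero (hb1 : ∀ j, 1 ≤ ‖b j‖) : deriv (PhiProd N q b) 0 = 1 := by
  have h := (hasDerivAt_id (0 : ℂ)).mul (hasDerivAt_phiFactor (q := q) hb1
    (z := 0) (by simp))
  have h' : HasDerivAt (PhiProd N q b) _ 0 := h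
  rw [h'.deriv]
  simp [phiFactor_zero]

end PhiProd

theorem norm_mul_exp_ofReal_mul (z s : ℂ) (r : ℝ) :
    ‖z * Complex.exp ((r : ℂ) * s)‖ = ‖z‖ * Real.exp (s.re * r) := by
  rw [norm_mul, Complex.norm_exp, Complex.re_ofReal_mul, mul_comm r]

theorem hasDerivAt_mul_exp_ofReal_mul (z s : ℂ) (r : ℝ) :
    HasDerivAt (fun r : ℝ => z * Complex.exp ((r : ℂ) * s))
      (z * Complex.exp ((r : ℂ) * s) * s) r := by
  have h : HasDerivAt (fun r : ℝ => (r : ℂ) * s) (1 * s) r :=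
    (Complex.ofRealCLM.hasDerivAt (x := r)).mul_const s
  refine (h.cexp.const_mul z).congr_deriv ?_
  ring

theorem tendsto_mul_exp_ofReal_mul (z : ℂ) {s : ℂ} (hs : s.re < 0) :
    Filter.Tendsto (fun r : ℝ => z * Complex.exp ((r : ℂ) * s)) Filter.atTop (nhds 0) := by
  rw [tendsto_zero_iff_norm_tendsto_zero]
  simp only [norm_mul_exp_ofReal_mul]
  have h : Filter.Tendsto (fun r : ℝ => s.re * r) Filter.atTop Filter.atBot :=
    Filter.tendsto_id.const_mul_atTop_of_neg hs
  simpa using (Real.tendsto_exp_atBot.comp h).const_mul ‖z‖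

/-- If `G' = c * h` on the unit disc and `G 0 = 0`, then integrating `w * h w` along the spiral
`w = z * exp (r * s)` recovers `G z`. -/
theorem integral_spiral_eq {G h : ℂ → ℂ} {c z s : ℂ} (hc : c ≠ 0) (hz : ‖z‖ < 1)
    (hs : s.re < 0) (hG : ∀ w : ℂ, ‖w‖ < 1 → HasDerivAt G (c * h w) w) (hG0 : G 0 = 0)
    (hh : ContinuousOn h (Metric.ball 0 1)) :
    ∫ r : ℝ in Set.Ioi (0 : ℝ), z * Complex.exp ((r : ℂ) * s) *
      h (z * Complex.exp ((r : ℂ) * s)) = -G z / (c * s) := by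
  set w : ℝ → ℂ := fun r => z * Complex.exp ((r : ℂ) * s) with hw
  have hs0 : s ≠ 0 := by
    rintro rfl
    simp at hs
  have hwz {r : ℝ} (hr : 0 ≤ r) : ‖w r‖ ≤ ‖z‖ := by
    rw [hw, norm_mul_exp_ofReal_mul]
    exact mul_le_of_le_one_right (norm_nonneg z)
      (Real.exp_le_one_iff.2 (mul_nonpos_of_nonpos_of_nonneg hs.le hr))
  have hwc : Continuous w :=
    continuous_iff_continuousAt.2 fun r => (hasDerivAt_mul_exp_ofReal_mul z s r).continuousAt
  have hderiv (r : ℝ) (hr : r ∈ Set.Ici (0 : ℝ)) :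
      HasDerivAt (fun r => G (w r)) ((c * s) * (w r * h (w r))) r := by
    refine ((hG (w r) ((hwz hr).trans_lt hz)).comp r
      (hasDerivAt_mul_exp_ofReal_mul z s r)).congr_deriv ?_
    simp only [hw]
    ring
  obtain ⟨M, hM⟩ := (isCompact_closedBall (0 : ℂ) ‖z‖).exists_bound_of_continuousOn
    (hh.mono (Metric.closedBall_subset_ball hz))
  have hint : IntegrableOn (fun r => w r * h (w r)) (Set.Ioi (0 : ℝ)) := by
    have hexp : IntegrableOn (fun r : ℝ => ‖z‖ * Real.exp (s.re * r) * M) (Set.Ioi (0 : ℝ)) :=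
      ((integrableOn_exp_mul_Ioi hs 0).const_mul ‖z‖).mul_const M
    refine Integrable.mono' hexp ?_ ?_
    · refine ContinuousOn.aestronglyMeasurable ?_ measurableSet_Ioi
      refine hwc.continuousOn.mul (hh.comp hwc.continuousOn fun r hr => ?_)
      exact mem_ball_zero_iff.2 ((hwz (le_of_lt hr)).trans_lt hz)
    · refine (ae_restrict_iff' measurableSet_Ioi).2 (.of_forall fun r hr => ?_)
      rw [norm_mul, hw, norm_mul_exp_ofReal_mul]
      exact mul_le_mul_of_nonneg_left
        (hM _ (mem_closedBall_zero_iff.2 (hwz (le_of_lt hr)))) (by positivity)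
  have hlim : Filter.Tendsto (fun r => G (w r)) Filter.atTop (nhds 0) := by
    have h0 := (hG 0 (by simp)).continuousAt.tendsto.comp (tendsto_mul_exp_ofReal_mul z hs)
    rwa [hG0] at h0
  have key := integral_Ioi_of_hasDerivAt_of_tendsto' hderiv (hint.const_mul (c * s)) hlim
  rw [integral_const_mul] at key
  rw [eq_div_iff (mul_ne_zero hc hs0), mul_comm, key]
  simp [hw]

/-- Corollary 1: for a polynomial `q` of degree `N ≥ 1` with nonnegative
coefficients and `q(0) = 0`, whose equation `q(z) = q(1)` has `N` distinct complex roots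
`b_1, …, b_N`, the function `Φ(z) = z·∏_j (1 − z/b_j)^(−1 − q(1)/(q'(b_j)b_j))` is
analytic on the open unit disc, satisfies `Φ(0) = 0`, `Φ'(0) = 1`, and solves
`∫_0^∞ Φ(z·exp(r(q(z) − q(1)))) dr = Φ(z)/q(1)` for every `0 < |z| < 1`. -/
theorem phiProd_solves_schroder (N : ℕ) (hN : 1 ≤ N) (q : Polynomial ℝ)
    (hdeg : q.natDegree = N) (hcoeff : ∀ i, 0 ≤ q.coeff i) (hq0 : q.coeff 0 = 0)
    (b : Fin N → ℂ) (hb : Function.Injective b)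
    (hroot : ∀ j, Polynomial.aeval (b j) q = ((q.eval 1 : ℝ) : ℂ)) :
    AnalyticOnNhd ℂ (PhiProd N q b) (Metric.ball 0 1) ∧ PhiProd N q b 0 = 0 ∧
    deriv (PhiProd N q b) 0 = 1 ∧
    ∀ z : ℂ, z ≠ 0 → ‖z‖ < 1 →
      ∫ r : ℝ in Set.Ioi (0 : ℝ),
          PhiProd N q b (z * Complex.exp ((r : ℂ) *
            (Polynomial.aeval z q - ((q.eval 1 : ℝ) : ℂ)))) =
        PhiProd N q b z / ((q.eval 1 : ℝ) : ℂ) := by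
  have hq : q ≠ 0 := by
    rintro rfl
    rw [natDegree_zero] at hdeg
    omega
  have hb1 (j : Fin N) : 1 ≤ ‖b j‖ := one_le_norm_of_aeval_eq_eval_one hq hcoeff hq0 (hroot j)
  refine ⟨(differentiableOn_phiProd hb1).analyticOnNhd Metric.isOpen_ball,
    by simp [phiProd_eq_mul], deriv_phiProd_zero hb1, fun z _ hz => ?_⟩
  have hA : ((q.eval 1 : ℝ) : ℂ) ≠ 0 :=
    Complex.ofReal_ne_zero.2 (eval_one_pos_of_coeff_nonneg hq hcoeff).ne'
  have hs := re_aeval_sub_eval_one_neg hq hcoeff hq0 hz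
  have hs0 : aeval z q - ((q.eval 1 : ℝ) : ℂ) ≠ 0 := fun h => by simp [h] at hs
  simp only [phiProd_eq_mul (z * Complex.exp _)]
  rw [integral_spiral_eq (neg_ne_zero.2 hA) hz hs
    (fun w hw => hasDerivAt_aeval_sub_mul_phiProd hN hdeg hq0 hb hroot hb1 hw)
    (by simp [phiProd_eq_mul])
    fun w hw => (hasDerivAt_phiFactor hb1
      (mem_ball_zero_iff.1 hw)).continuousAt.continuousWithinAt]
  field_simp
end
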